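/- arXiv:1912.05253 — 2 statements merged into one kernel-verified Lean document; each statement's English description precedes it below -/
import Mathlib

section
/- The only square factor of W_{2k-1}^(k) is the word kk (the digit k repeated twice). -/
def kbon (k : ℕ) (n : ℕ) : ℕ :=
  if _h1 : n < k - 1 then 0
  else if _h2 : n = k - 1 then 1
  else ∑ i ∈ Finset.range k, kbon k (n - i - 1)
termination_by n
decreasing_by omega

/-- The k-bonacci morphism on words over ℕ. -/
def phiW (k : ℕ) (w : List ℕ) : List ℕ :=
  w.flatMap (fun a => if a % k = k - 1 then [a + 1] else [k * (a / k), a + 1])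

/-- The finite k-bonacci word over the infinite alphabet ℕ. -/
def W (k n : ℕ) : List ℕ := (phiW k)^[n] [0]

theorem mod_eq_pred_iff_dvd_succ {k : ℕ} (hk : 2 < k) (a : ℕ) : a % k = k - 1 ↔ k ∣ a + 1 := by
  rw [Nat.dvd_iff_mod_eq_zero, Nat.add_mod, Nat.mod_eq_of_lt (show 1 < k by omega)]
  have h := Nat.mod_lt a (show 0 < k by omega)
  constructor
  · intro h'
    rw [h', Nat.sub_add_cancel (by omega), Nat.mod_self]
  · intro h'
    by_contra hne
    rw [Nat.mod_eq_of_lt (by omega)] at h'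
    omega

theorem phiW_append (k : ℕ) (u v : List ℕ) : phiW k (u ++ v) = phiW k u ++ phiW k v := by
  simp [phiW]

theorem phiW_cons_of_dvd {k : ℕ} (hk : 2 < k) {a : ℕ} (h : k ∣ a + 1) (w : List ℕ) :
    phiW k (a :: w) = (a + 1) :: phiW k w := by
  simp [phiW, (mod_eq_pred_iff_dvd_succ hk a).2 h]

theorem phiW_cons_of_not_dvd {k : ℕ} (hk : 2 < k) {a : ℕ} (h : ¬ k ∣ a + 1) (w : List ℕ) :
    phiW k (a :: w) = (k * (a / k)) :: (a + 1) :: phiW k w := by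
  simp [phiW, mt (mod_eq_pred_iff_dvd_succ hk a).1 h]

theorem W_succ (k n : ℕ) : W k (n + 1) = phiW k (W k n) := by
  simp [W, Function.iterate_succ_apply']

/-- Inversion of `phiW` at the first letter of an image. -/
theorem phiW_eq_cons {k : ℕ} (hk : 2 < k) {w q : List ℕ} {x : ℕ} (h : phiW k w = x :: q) :
    ∃ a t, w = a :: t ∧ ((k ∣ a + 1 ∧ x = a + 1 ∧ q = phiW k t) ∨
      (¬ k ∣ a + 1 ∧ x = k * (a / k) ∧ q = (a + 1) :: phiW k t)) := by
  cases w with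
  | nil => simp [phiW] at h
  | cons a t =>
    refine ⟨a, t, rfl, ?_⟩
    by_cases hd : k ∣ a + 1
    · rw [phiW_cons_of_dvd hk hd] at h
      simp only [List.cons.injEq] at h
      exact .inl ⟨hd, h.1.symm, h.2.symm⟩
    · rw [phiW_cons_of_not_dvd hk hd] at h
      simp only [List.cons.injEq] at h
      exact .inr ⟨hd, h.1.symm, h.2.symm⟩

theorem dvd_of_phiW_eq_cons {k : ℕ} (hk : 2 < k) {w q : List ℕ} {x : ℕ}
    (h : phiW k w = x :: q) : k ∣ x := by
  obtain ⟨a, t, -, ⟨hd, rfl, -⟩ | ⟨-, rfl, -⟩⟩ := phiW_eq_cons hk h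
  · exact hd
  · exact Nat.dvd_mul_right _ _

theorem phiW_injective {k : ℕ} (hk : 2 < k) : Function.Injective (phiW k) := by
  intro u
  induction u with
  | nil =>
    intro v h
    cases v with
    | nil => rfl
    | cons a t =>
      by_cases hd : k ∣ a + 1
      · rw [phiW_cons_of_dvd hk hd] at h
        simp [phiW] at h
      · rw [phiW_cons_of_not_dvd hk hd] at h
        simp [phiW] at h
  | cons a t ih =>
    intro v h
    by_cases hd : k ∣ a + 1
    · rw [phiW_cons_of_dvd hk hd] at h
      obtain ⟨b, s, rfl, ⟨-, hx, hq⟩ | ⟨hb, -, hq⟩⟩ := phiW_eq_cons hk h.symm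
      · rw [ih hq, Nat.succ_injective hx]
      · exact absurd (dvd_of_phiW_eq_cons hk hq) hb
    · rw [phiW_cons_of_not_dvd hk hd] at h
      obtain ⟨b, s, rfl, ⟨-, -, hq⟩ | ⟨-, -, hq⟩⟩ := phiW_eq_cons hk h.symm
      · exact absurd (dvd_of_phiW_eq_cons hk hq.symm) hd
      · simp only [List.cons.injEq] at hq
        rw [ih hq.2, Nat.succ_injective hq.1]

/-- An image under `phiW` can be cut before every letter divisible by `k`, and after every
other letter. -/
theorem phiW_eq_append_cons {k : ℕ} (hk : 2 < k) {w p q : List ℕ} {x : ℕ}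
    (h : phiW k w = p ++ x :: q) :
    (k ∣ x ∧ ∃ u v, w = u ++ v ∧ phiW k u = p ∧ phiW k v = x :: q) ∨
    (¬ k ∣ x ∧ ∃ u a v, w = u ++ a :: v ∧ x = a + 1 ∧ p = phiW k u ++ [k * (a / k)] ∧
      phiW k v = q) := by
  induction w generalizing p with
  | nil => simp [phiW] at h
  | cons a t ih =>
    rcases p with _ | ⟨y, p⟩
    · exact .inl ⟨dvd_of_phiW_eq_cons hk h, [], a :: t, rfl, rfl, h⟩
    by_cases hd : k ∣ a + 1
    · rw [phiW_cons_of_dvd hk hd, List.cons_append, List.cons.injEq] at h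
      obtain ⟨rfl, h⟩ := h
      obtain ⟨hx, u, v, rfl, rfl, hv⟩ | ⟨hx, u, b, v, rfl, rfl, rfl, hv⟩ := ih h
      · exact .inl ⟨hx, a :: u, v, rfl, phiW_cons_of_dvd hk hd u, hv⟩
      · exact .inr ⟨hx, a :: u, b, v, rfl, rfl, by simp [phiW_cons_of_dvd hk hd], hv⟩
    · rw [phiW_cons_of_not_dvd hk hd, List.cons_append, List.cons.injEq] at h
      obtain ⟨rfl, h⟩ := h
      rcases p with _ | ⟨y, p⟩
      · rw [List.nil_append, List.cons.injEq] at h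
        obtain ⟨rfl, h⟩ := h
        exact .inr ⟨hd, [], a, t, rfl, rfl, rfl, h⟩
      · rw [List.cons_append, List.cons.injEq] at h
        obtain ⟨rfl, h⟩ := h
        obtain ⟨hx, u, v, rfl, rfl, hv⟩ | ⟨hx, u, b, v, rfl, rfl, rfl, hv⟩ := ih h
        · exact .inl ⟨hx, a :: u, v, rfl, phiW_cons_of_not_dvd hk hd u, hv⟩
        · exact .inr ⟨hx, a :: u, b, v, rfl, rfl, by simp [phiW_cons_of_not_dvd hk hd], hv⟩

/-- A letter not divisible by `k` in an image is preceded by the multiple of `k` below it. -/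
theorem eq_concat_of_not_dvd {k : ℕ} (hk : 2 < k) {w p q : List ℕ} {x : ℕ}
    (h : phiW k w = p ++ x :: q) (hx : ¬ k ∣ x) : ∃ r, p = r ++ [k * (x / k)] := by
  obtain ⟨hd, -⟩ | ⟨-, u, a, v, -, rfl, rfl, -⟩ := phiW_eq_append_cons hk h
  · exact absurd hd hx
  · exact ⟨phiW k u, by rw [Nat.succ_div_of_not_dvd hx]⟩

theorem eq_of_adjacent_not_dvd {k : ℕ} (hk : 2 < k) {w p q : List ℕ} {e x : ℕ}
    (h : phiW k w = p ++ e :: x :: q) (hx : ¬ k ∣ x) : e = k * (x / k) := by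
  obtain ⟨r, hr⟩ := eq_concat_of_not_dvd hk (p := p ++ [e]) (by simpa using h) hx
  exact (List.concat_inj.1 (by simpa using hr)).2

/-- In an image, the letter `0` is followed by a letter less than `k`. -/
theorem lt_of_zero_adjacent {k : ℕ} (hk : 2 < k) {w p q : List ℕ} {x : ℕ}
    (h : phiW k w = p ++ 0 :: x :: q) : x < k := by
  obtain ⟨-, u, v, -, -, hv⟩ | ⟨h0, -⟩ := phiW_eq_append_cons hk h
  · obtain ⟨a, t, -, ⟨-, h0, -⟩ | ⟨ha, h0, hq⟩⟩ := phiW_eq_cons hk hv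
    · omega
    · simp only [List.cons.injEq] at hq
      have hak : a < k := by
        by_contra hle
        have := Nat.div_pos (not_lt.1 hle) (by omega)
        have := Nat.mul_pos (show 0 < k by omega) this
        omega
      have : a + 1 ≠ k := fun e => ha (e ▸ dvd_rfl)
      omega
  · exact absurd (dvd_zero k) h0

theorem le_of_mem_W (k n : ℕ) : ∀ x ∈ W k n, x ≤ n := by
  induction n with
  | zero => simp [W]
  | succ n ih =>
    intro x hx
    rw [W_succ, phiW, List.mem_flatMap] at hx
    obtain ⟨a, ha, hx⟩ := hx
    have h1 := ih a ha
    have h2 := Nat.mul_div_le a k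
    split_ifs at hx <;> simp at hx <;> omega

/-- A letter `j < k` is followed by a letter at least `k` only from `W k (k + j - 1)` on. -/
theorem le_of_adjacent {k : ℕ} (hk : 2 < k) (n : ℕ) {j c : ℕ} {p q : List ℕ}
    (hj : j < k) (hc : k ≤ c) (h : W k n = p ++ j :: c :: q) : k + j ≤ n + 1 := by
  induction n generalizing j c p q with
  | zero =>
    have := congrArg List.length h
    simp [W] at this
    omega
  | succ n ih =>
    rw [W_succ] at h
    obtain rfl | hj0 := Nat.eq_zero_or_pos j
    · have := lt_of_zero_adjacent hk h
      omega
    obtain ⟨hd, -⟩ | ⟨-, u, a, v, hw, rfl, -, hv⟩ := phiW_eq_append_cons hk h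
    · exact absurd (Nat.le_of_dvd hj0 hd) (by omega)
    obtain ⟨d, t, rfl, hdt⟩ := phiW_eq_cons hk hv
    have h2 := Nat.mul_div_le d k
    have hdk : k - 1 ≤ d := by omega
    obtain hdk' | hdk' := Nat.lt_or_ge d k
    · have hn : d ≤ n := le_of_mem_W k n d (by simp [hw])
      obtain rfl | ha := Nat.eq_zero_or_pos a
      · omega
      · cases n with
        | zero => omega
        | succ n =>
          rw [W_succ] at hw
          have hnd : ¬ k ∣ d := fun h => absurd (Nat.le_of_dvd (by omega) h) (by omega)
          have := eq_of_adjacent_not_dvd hk hw hnd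
          rw [Nat.div_eq_of_lt hdk'] at this
          omega
    · have := ih (by omega) hdk' hw
      omega

/-- The case of a square whose root starts with a multiple of `k`. -/
theorem eq_of_square_of_dvd {k : ℕ} (hk : 2 < k) {n : ℕ} (hn : n + 1 ≤ 2 * k - 1)
    (hfree : ∀ V p s, V ≠ [] → W k n ≠ p ++ V ++ V ++ s)
    {x : ℕ} {U p s : List ℕ} (hx : k ∣ x)
    (h : W k (n + 1) = p ++ (x :: U) ++ (x :: U) ++ s) :
    x :: U = [k] ∧ n + 1 = 2 * k - 1 := by
  rw [W_succ] at h
  obtain ⟨-, w₁, w', hw, hp, hw'⟩ | ⟨hx', -⟩ :=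
    phiW_eq_append_cons hk (p := p) (x := x) (q := U ++ x :: U ++ s) (by simpa using h)
  swap
  · exact absurd hx hx'
  obtain ⟨-, w₂, w₃, rfl, hw₂, hw₃⟩ | ⟨hx', -⟩ :=
    phiW_eq_append_cons hk (p := x :: U) (x := x) (q := U ++ s) (by simpa using hw')
  swap
  · exact absurd hx hx'
  have hne : w₂ ≠ [] := by
    rintro rfl
    simp [phiW] at hw₂
  rcases s with _ | ⟨a, s⟩
  · have : w₃ = w₂ := phiW_injective hk (by rw [hw₂, hw₃]; simp)
    exact absurd (by simp [hw, this]) (hfree w₂ w₁ [] hne)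
  obtain ⟨-, w₄, w₅, rfl, hw₄, -⟩ | ⟨ha, v, b, w₅, rfl, rfl, hv, -⟩ :=
    phiW_eq_append_cons hk (p := x :: U) (x := a) (q := s) (by simpa using hw₃)
  · have : w₄ = w₂ := phiW_injective hk (by rw [hw₂, hw₄])
    exact absurd (by simp [hw, this]) (hfree w₂ w₁ w₅ hne)
  rw [hv] at hw₂
  obtain ⟨-, v', r, rfl, hv', hr⟩ | ⟨hb, -⟩ := phiW_eq_append_cons hk hw₂
  swap
  · exact absurd (Nat.dvd_mul_right _ _) hb
  obtain rfl := phiW_injective hk hv'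
  obtain ⟨d, t, rfl, ⟨-, hd, ht⟩ | ⟨-, -, ht⟩⟩ := phiW_eq_cons hk hr
  swap
  · simp at ht
  obtain rfl : t = [] := phiW_injective hk (by rw [← ht]; rfl)
  have hbn : b ≤ n := le_of_mem_W k n b (by simp [hw])
  have hq : b / k = 1 := by
    have h1 : b / k < 2 := (Nat.div_lt_iff_lt_mul (by omega)).2 (by omega)
    have h0 : b / k ≠ 0 := by
      intro h0
      rw [h0] at hd
      omega
    exact le_antisymm (Nat.lt_succ_iff.1 h1) (Nat.pos_of_ne_zero h0)
  rw [hq, mul_one] at hd hv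
  have hkb : k ≤ b := by
    by_contra hlt
    rw [Nat.div_eq_of_lt (not_le.1 hlt)] at hq
    omega
  obtain rfl | ⟨y, e, rfl⟩ := v'.eq_nil_or_concat'
  · have := le_of_adjacent hk n (j := d) (c := b) (p := w₁) (q := w₅) (by omega) hkb
      (by simpa using hw)
    exact ⟨by simpa [phiW] using hv, by omega⟩
  · exfalso
    cases n with
    | zero => omega
    | succ n =>
      rw [W_succ] at hw
      have hnd : ¬ k ∣ d := fun h => absurd (Nat.le_of_dvd (by omega) h) (by omega)
      have he : e = k * (d / k) := eq_of_adjacent_not_dvd hk (p := w₁ ++ y) (x := d)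
        (q := y ++ e :: b :: w₅) (by simpa using hw) hnd
      rw [Nat.div_eq_of_lt (by omega), mul_zero] at he
      subst he
      have := lt_of_zero_adjacent hk (p := w₁ ++ y ++ 0 :: d :: y) (x := b) (q := w₅)
        (by simpa using hw)
      omega

theorem eq_of_square {k : ℕ} (hk : 2 < k) {n : ℕ} (hn : n ≤ 2 * k - 1) {U p s : List ℕ}
    (hU : U ≠ []) (h : W k n = p ++ U ++ U ++ s) : U = [k] ∧ n = 2 * k - 1 := by
  induction n generalizing U p s with
  | zero =>
    have := congrArg List.length h
    have := List.length_pos_iff.2 hU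
    simp [W] at *
    omega
  | succ n ih =>
    have hfree : ∀ V p s, V ≠ [] → W k n ≠ p ++ V ++ V ++ s := by
      intro V p s hV hW
      have := (ih (by omega) hV hW).2
      omega
    rcases U with _ | ⟨x, U⟩
    · exact absurd rfl hU
    by_cases hx : k ∣ x
    · exact eq_of_square_of_dvd hk hn hfree hx h
    exfalso
    have h' := h
    rw [W_succ] at h'
    obtain ⟨r, rfl⟩ := eq_concat_of_not_dvd hk (p := p) (x := x) (q := U ++ x :: U ++ s)
      (by simpa using h') hx
    obtain rfl | ⟨V, e, rfl⟩ := U.eq_nil_or_concat'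
    · have := eq_of_adjacent_not_dvd hk (p := r ++ [k * (x / k)]) (e := x) (x := x) (q := s)
        (by simpa using h') hx
      exact hx (this ▸ Nat.dvd_mul_right _ _)
    · have he := eq_of_adjacent_not_dvd hk (p := r ++ [k * (x / k)] ++ x :: V) (e := e) (x := x)
        (q := V ++ e :: s) (by simpa using h') hx
      have := (eq_of_square_of_dvd hk hn hfree (x := e) (U := x :: V) (p := r) (s := e :: s)
        (he ▸ Nat.dvd_mul_right _ _) (by rw [h, ← he]; simp)).1
      simp at this

theorem mem_W_self {k : ℕ} (n : ℕ) : n ∈ W k n := by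
  induction n with
  | zero => simp [W]
  | succ n ih =>
    rw [W_succ, phiW, List.mem_flatMap]
    refine ⟨n, ih, ?_⟩
    split_ifs <;> simp

/-- The factor `j k` occurs in `W k (k + j - 1)` for `1 ≤ j < k`. -/
theorem exists_adjacent {k : ℕ} (hk : 2 < k) (j : ℕ) (hj : j + 1 < k) :
    ∃ p q, W k (k + j) = p ++ (j + 1) :: k :: q := by
  induction j with
  | zero =>
    obtain ⟨m, rfl⟩ : ∃ m, k = m + 2 := ⟨k - 2, by omega⟩
    obtain ⟨p, q, h⟩ := List.append_of_mem (mem_W_self (k := m + 2) m)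
    have h1 : ¬ m + 2 ∣ m + 1 := fun h => absurd (Nat.le_of_dvd (by omega) h) (by omega)
    have h0 : ¬ m + 2 ∣ 0 + 1 := fun h => absurd (Nat.le_of_dvd (by omega) h) (by omega)
    refine ⟨phiW (m + 2) (phiW (m + 2) p) ++ [0], phiW (m + 2) (phiW (m + 2) q), ?_⟩
    rw [add_zero, W_succ, W_succ, h, phiW_append, phiW_cons_of_not_dvd hk h1,
      Nat.div_eq_of_lt (by omega), mul_zero, phiW_append, phiW_cons_of_not_dvd hk h0,
      phiW_cons_of_dvd hk dvd_rfl]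
    simp
  | succ j ih =>
    obtain ⟨p, q, h⟩ := ih (by omega)
    have h1 : ¬ k ∣ j + 1 + 1 := fun h => absurd (Nat.le_of_dvd (by omega) h) (by omega)
    have h2 : ¬ k ∣ k + 1 := by
      rw [Nat.dvd_add_right dvd_rfl]
      exact fun h => absurd (Nat.le_of_dvd (by omega) h) (by omega)
    refine ⟨phiW k p ++ [k * ((j + 1) / k)], (k + 1) :: phiW k q, ?_⟩
    rw [← add_assoc, W_succ, h, phiW_append, phiW_cons_of_not_dvd hk h1,
      phiW_cons_of_not_dvd hk h2, Nat.div_self (by omega)]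
    simp

theorem square_of_W2k1 (k : ℕ) (hk : 2 < k) :
    ∀ U : List ℕ, U ≠ [] → ((U ++ U) <:+: W k (2 * k - 1) ↔ U = [k]) := by
  intro U hU
  constructor
  · rintro ⟨p, s, h⟩
    exact (eq_of_square hk le_rfl hU (p := p) (s := s) (by simp [← h])).1
  · rintro rfl
    obtain ⟨p, q, h⟩ := exists_adjacent hk (k - 2) (by omega)
    have h1 : k ∣ k - 2 + 1 + 1 := by
      rw [show k - 2 + 1 + 1 = k by omega]
    have h2 : ¬ k ∣ k + 1 := by
      rw [Nat.dvd_add_right dvd_rfl]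
      exact fun h => absurd (Nat.le_of_dvd (by omega) h) (by omega)
    refine ⟨phiW k p, (k + 1) :: phiW k q, ?_⟩
    rw [show 2 * k - 1 = k + (k - 2) + 1 by omega, W_succ, h, phiW_append,
      phiW_cons_of_dvd hk h1, phiW_cons_of_not_dvd hk h2, Nat.div_self (by omega),
      show k - 2 + 1 + 1 = k by omega]
    simp
end

section
/- Let k ≥ 3. The critical exponent of the infinite k-bonacci word W^(k) on the infinite alphabet ℕ equals 3 - 3/(2^k - 1); that is, the supremum over all nonempty factors U of W^(k) of max{r ∈ ℚ : U^r is a factor of W^(k)} equals 3 - 3/(2^k - 1). -/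
theorem W_zero (k : ℕ) : W k 0 = [0] := rfl

@[simp] theorem phiW_nil (k : ℕ) : phiW k [] = [] := rfl

theorem phiW_single {k a : ℕ} (h : a % k = k - 1) : phiW k [a] = [a + 1] := by
  simp [phiW, h]

theorem phiW_double {k a : ℕ} (h : a % k ≠ k - 1) : phiW k [a] = [k * (a / k), a + 1] := by
  simp [phiW, h]

theorem phiW_zero_cons {k : ℕ} (hk : 2 ≤ k) (u : List ℕ) :
    phiW k (0 :: u) = 0 :: 1 :: phiW k u := by
  have h0 : 0 % k ≠ k - 1 := by rw [Nat.zero_mod]; omega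
  have := phiW_append k [0] u
  rw [phiW_double h0] at this
  simpa using this

theorem phiW_isPrefix {k : ℕ} {u v : List ℕ} (h : u <+: v) : phiW k u <+: phiW k v := by
  obtain ⟨t, rfl⟩ := h
  exact ⟨phiW k t, (phiW_append k u t).symm⟩

theorem length_phiW_singleton_pos (k a : ℕ) : 1 ≤ (phiW k [a]).length := by
  by_cases h : a % k = k - 1
  · simp [phiW_single h]
  · simp [phiW_double h]

theorem length_le_length_phiW (k : ℕ) (u : List ℕ) : u.length ≤ (phiW k u).length := by
  induction u with
  | nil => simp
  | cons a u ih =>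
    have := phiW_append k [a] u
    have h1 := length_phiW_singleton_pos k a
    simp only [List.singleton_append] at this
    rw [this, List.length_append, List.length_cons]
    omega

theorem length_phiW_le (k : ℕ) (u : List ℕ) : (phiW k u).length ≤ 2 * u.length := by
  induction u with
  | nil => simp
  | cons a u ih =>
    have := phiW_append k [a] u
    have h1 : (phiW k [a]).length ≤ 2 := by
      by_cases h : a % k = k - 1
      · simp [phiW_single h]
      · simp [phiW_double h]
    simp only [List.singleton_append] at this
    rw [this, List.length_append, List.length_cons]
    omega

theorem phiW_map_add {k : ℕ} (hk : 0 < k) (q : ℕ) (u : List ℕ) :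
    phiW k (u.map (· + k * q)) = (phiW k u).map (· + k * q) := by
  induction u with
  | nil => simp
  | cons a u ih =>
    have h1 := phiW_append k [a] u
    have h2 := phiW_append k [a + k * q] (u.map (· + k * q))
    simp only [List.singleton_append] at h1 h2
    rw [List.map_cons, h1, h2, List.map_append, ih]
    congr 1
    by_cases h : a % k = k - 1
    · have h' : (a + k * q) % k = k - 1 := by rwa [Nat.add_mul_mod_self_left]
      rw [phiW_single h, phiW_single h']
      simp only [List.map_cons, List.map_nil, List.cons.injEq, and_true]
      omega
    · have h' : (a + k * q) % k ≠ k - 1 := by rwa [Nat.add_mul_mod_self_left]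
      rw [phiW_double h, phiW_double h', Nat.add_mul_div_left _ _ hk]
      simp only [List.map_cons, List.map_nil, List.cons.injEq, and_true]
      constructor
      · ring
      · omega

theorem W_isPrefix_succ {k : ℕ} (hk : 2 ≤ k) (n : ℕ) : W k n <+: W k (n + 1) := by
  induction n with
  | zero => rw [W_succ, W_zero, phiW_zero_cons hk]; exact ⟨[1], rfl⟩
  | succ n ih => rw [W_succ k n, W_succ k (n + 1)]; exact phiW_isPrefix ih

theorem W_isPrefix {k : ℕ} (hk : 2 ≤ k) {m n : ℕ} (h : m ≤ n) : W k m <+: W k n := by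
  induction n, h using Nat.le_induction with
  | base => exact List.prefix_refl _
  | succ n _ ih => exact ih.trans (W_isPrefix_succ hk n)

theorem lt_length_W {k : ℕ} (hk : 2 ≤ k) (n : ℕ) : n < (W k n).length := by
  induction n with
  | zero => simp [W_zero]
  | succ n ih =>
    obtain ⟨t, ht⟩ := W_isPrefix hk (Nat.zero_le n)
    rw [W_zero, List.singleton_append] at ht
    rw [W_succ, ← ht, phiW_zero_cons hk]
    have := length_le_length_phiW k t
    rw [← ht] at ih
    simp only [List.length_cons] at ih ⊢
    omega

/-- The letter at position `i` of the infinite `k`-bonacci word. -/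
def letter (k i : ℕ) : ℕ := (W k i).getD i 0

/-- The factor of length `l` starting at position `s` of the infinite `k`-bonacci word. -/
def seg (k s l : ℕ) : List ℕ := (List.range' s l).map (letter k)

@[simp] theorem length_seg (k s l : ℕ) : (seg k s l).length = l := by simp [seg]

theorem seg_add (k s a b : ℕ) : seg k s (a + b) = seg k s a ++ seg k (s + a) b := by
  simp [seg, ← List.map_append, List.range'_append_1]

theorem seg_one (k s : ℕ) : seg k s 1 = [letter k s] := rfl

theorem seg_two (k s : ℕ) : seg k s 2 = [letter k s, letter k (s + 1)] := rfl

theorem getElem?_seg {k s l i : ℕ} (h : i < l) : (seg k s l)[i]? = some (letter k (s + i)) := by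
  simp [seg, h]

theorem W_eq_seg {k : ℕ} (hk : 2 ≤ k) (n : ℕ) : W k n = seg k 0 (W k n).length := by
  apply List.ext_getElem?
  intro i
  by_cases hi : i < (W k n).length
  · rw [getElem?_seg hi, Nat.zero_add, letter, List.getD_eq_getElem?_getD]
    have hi' := lt_length_W hk i
    rw [List.getElem?_eq_getElem hi, List.getElem?_eq_getElem hi', Option.getD_some]
    rcases le_total n i with h | h
    · rw [(W_isPrefix hk h).getElem hi]
    · rw [(W_isPrefix hk h).getElem hi']
  · rw [List.getElem?_eq_none (by omega), List.getElem?_eq_none (by simp; omega)]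

theorem seg_infix_W {k : ℕ} (hk : 2 ≤ k) (s l : ℕ) : seg k s l <:+: W k (s + l) := by
  have h := lt_length_W hk (s + l)
  obtain ⟨d, hd⟩ := Nat.exists_eq_add_of_lt h
  rw [W_eq_seg hk, hd, show s + l + d + 1 = s + (l + (d + 1)) by omega, seg_add, seg_add,
    Nat.zero_add]
  exact ⟨_, _, List.append_assoc _ _ _⟩

/-- The position at which the image of the letter at position `m` starts. -/
def pos (k m : ℕ) : ℕ := (phiW k (seg k 0 m)).length

theorem phiW_seg_zero {k : ℕ} (hk : 2 ≤ k) (m : ℕ) :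
    phiW k (seg k 0 m) = seg k 0 (pos k m) := by
  have hm := lt_length_W hk m
  have h1 : seg k 0 m <+: W k m := by
    obtain ⟨d, hd⟩ := Nat.exists_eq_add_of_lt hm
    rw [W_eq_seg hk m, hd, Nat.add_assoc, seg_add]
    exact ⟨_, rfl⟩
  have h2 := phiW_isPrefix (k := k) h1
  rw [← W_succ, W_eq_seg hk (m + 1)] at h2
  have hl := h2.length_le
  rw [length_seg] at hl
  obtain ⟨d, hd⟩ := Nat.exists_eq_add_of_le hl
  rw [hd, seg_add] at h2
  exact List.IsPrefix.eq_of_length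
    (List.prefix_of_prefix_length_le h2 (List.prefix_append _ _) (by simp [pos])) (by simp [pos])

theorem pos_add (k m l : ℕ) : pos k (m + l) = pos k m + (phiW k (seg k m l)).length := by
  rw [pos, pos, seg_add, phiW_append, List.length_append, Nat.zero_add]

theorem phiW_seg {k : ℕ} (hk : 2 ≤ k) (m l : ℕ) :
    phiW k (seg k m l) = seg k (pos k m) (phiW k (seg k m l)).length := by
  have h := phiW_seg_zero hk (m + l)
  rw [pos_add, seg_add, seg_add, phiW_append, phiW_seg_zero hk, Nat.zero_add, Nat.zero_add] at h
  exact List.append_cancel_left h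

theorem pos_zero (k : ℕ) : pos k 0 = 0 := rfl

theorem pos_mono (k : ℕ) {a b : ℕ} (h : a ≤ b) : pos k a ≤ pos k b := by
  obtain ⟨d, rfl⟩ := Nat.exists_eq_add_of_le h
  rw [pos_add]
  omega

theorem pos_lt_pos_succ (k m : ℕ) : pos k m < pos k (m + 1) := by
  rw [pos_add, seg_one]
  have := length_phiW_singleton_pos k (letter k m)
  omega

theorem pos_strictMono (k : ℕ) : StrictMono (pos k) := strictMono_nat_of_lt_succ (pos_lt_pos_succ k)

theorem image_single {k m : ℕ} (hk : 2 ≤ k) (h : letter k m % k = k - 1) :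
    pos k (m + 1) = pos k m + 1 ∧ letter k (pos k m) = letter k m + 1 := by
  have h1 := phiW_seg hk m 1
  rw [pos_add, seg_one, phiW_single h]
  rw [seg_one, phiW_single h, List.length_singleton, seg_one] at h1
  simp at h1
  exact ⟨rfl, h1.symm⟩

theorem image_double {k m : ℕ} (hk : 2 ≤ k) (h : letter k m % k ≠ k - 1) :
    pos k (m + 1) = pos k m + 2 ∧ letter k (pos k m) = k * (letter k m / k) ∧
      letter k (pos k m + 1) = letter k m + 1 := by
  have h1 := phiW_seg hk m 1
  rw [pos_add, seg_one, phiW_double h]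
  rw [seg_one, phiW_double h, show [k * (letter k m / k), letter k m + 1].length = 2 from rfl,
    seg_two] at h1
  simp at h1
  exact ⟨rfl, h1.1.symm, h1.2.symm⟩

theorem letter_pos_mod {k : ℕ} (hk : 2 ≤ k) (m : ℕ) : letter k (pos k m) % k = 0 := by
  by_cases h : letter k m % k = k - 1
  · rw [(image_single hk h).2, Nat.add_mod, h, Nat.mod_eq_of_lt (by omega : 1 < k),
      Nat.sub_add_cancel (by omega), Nat.mod_self]
  · rw [(image_double hk h).2.1, Nat.mul_mod_right]

theorem letter_pos {k : ℕ} (hk : 2 ≤ k) (m : ℕ) :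
    letter k (pos k m) = k * ((letter k m + 1) / k) := by
  by_cases h : letter k m % k = k - 1
  · have h1 := (image_single hk h).2
    have h2 := Nat.div_add_mod (letter k (pos k m)) k
    rw [letter_pos_mod hk, h1] at h2
    rw [h1]
    omega
  · rw [(image_double hk h).2.1, Nat.succ_div_of_not_dvd]
    intro hd
    have h2 := Nat.mod_lt (letter k m) (by omega : k > 0)
    have h3 := Nat.mod_eq_zero_of_dvd hd
    rw [Nat.add_mod, Nat.mod_eq_of_lt (by omega : 1 < k), Nat.mod_eq_of_lt (by omega)] at h3
    omega

theorem succ_mod_of_double {k a : ℕ} (hk : 2 ≤ k) (h : a % k ≠ k - 1) :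
    (a + 1) % k = a % k + 1 ∧ (a + 1) / k = a / k := by
  have h2 := Nat.mod_lt a (by omega : k > 0)
  have h3 : (a + 1) % k = a % k + 1 := by
    rw [Nat.add_mod, Nat.mod_eq_of_lt (by omega : 1 < k), Nat.mod_eq_of_lt (by omega)]
  refine ⟨h3, Nat.succ_div_of_not_dvd fun hd => ?_⟩
  have := Nat.mod_eq_zero_of_dvd hd
  omega

theorem exists_pos {k : ℕ} (hk : 2 ≤ k) (i : ℕ) :
    ∃ m, i = pos k m ∨ (i = pos k m + 1 ∧ letter k m % k ≠ k - 1) := by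
  induction i with
  | zero => exact ⟨0, Or.inl rfl⟩
  | succ i ih =>
    obtain ⟨m, h | ⟨h, hm⟩⟩ := ih
    · by_cases hm : letter k m % k = k - 1
      · exact ⟨m + 1, Or.inl (by rw [(image_single hk hm).1, h])⟩
      · exact ⟨m, Or.inr ⟨by rw [h], hm⟩⟩
    · exact ⟨m + 1, Or.inl (by rw [(image_double hk hm).1, h])⟩

theorem exists_eq_pos_of_mod_eq_zero {k i : ℕ} (hk : 2 ≤ k) (h : letter k i % k = 0) :
    ∃ m, i = pos k m := by
  obtain ⟨m, h1 | ⟨h1, hm⟩⟩ := exists_pos hk i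
  · exact ⟨m, h1⟩
  · rw [h1, (image_double hk hm).2.2, (succ_mod_of_double hk hm).1] at h
    omega

theorem letter_eq_of_succ_mod_ne_zero {k i : ℕ} (hk : 2 ≤ k) (h : letter k (i + 1) % k ≠ 0) :
    letter k i = k * (letter k (i + 1) / k) := by
  obtain ⟨m, h1 | ⟨h1, hm⟩⟩ := exists_pos hk (i + 1)
  · rw [h1, letter_pos_mod hk] at h
    exact absurd rfl h
  · have h2 : i = pos k m := by omega
    rw [h1, (image_double hk hm).2.2, (succ_mod_of_double hk hm).2, h2, (image_double hk hm).2.1]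

theorem letter_zero (k : ℕ) : letter k 0 = 0 := rfl

theorem lt_pos {k m : ℕ} (hk : 2 ≤ k) (hm : 0 < m) : m < pos k m := by
  induction m, hm using Nat.le_induction with
  | base =>
    have h : letter k 0 % k ≠ k - 1 := by rw [letter_zero, Nat.zero_mod]; omega
    have h1 := (image_double hk h).1
    rw [pos_zero, Nat.zero_add] at h1
    exact h1 ▸ Nat.one_lt_two
  | succ m _ ih =>
    have := pos_lt_pos_succ k m
    omega

theorem level_succ {k : ℕ} (hk : 2 ≤ k) (i : ℕ)
    (h : letter k i / k < letter k (i + 1) / k) :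
    letter k (i + 1) = k * (letter k i / k + 1) ∧ letter k i % k ≠ 0 := by
  induction i using Nat.strong_induction_on with
  | _ i ih =>
    have hk0 : 0 < k := by omega
    by_cases hb : letter k (i + 1) % k = 0
    swap
    · rw [letter_eq_of_succ_mod_ne_zero hk hb, Nat.mul_div_cancel_left _ hk0] at h
      exact absurd h (lt_irrefl _)
    obtain ⟨m', hm'⟩ := exists_eq_pos_of_mod_eq_zero hk hb
    obtain ⟨m, rfl⟩ : ∃ m, m' = m + 1 := by
      cases m' with
      | zero => simp [pos_zero] at hm'
      | succ m => exact ⟨m, rfl⟩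
    have hi : letter k i = letter k m + 1 := by
      by_cases hs : letter k m % k = k - 1
      · have h1 := image_single hk hs
        rw [← h1.2]; congr 1; omega
      · have h1 := image_double hk hs
        rw [← h1.2.2]; congr 1; omega
    have hmi : m < i := by
      have : m + 1 < pos k (m + 1) := lt_pos hk (Nat.succ_pos m)
      omega
    rw [hm', letter_pos hk, hi, Nat.mul_div_cancel_left _ hk0] at h
    rw [hm', letter_pos hk, hi]
    have ih := ih m hmi
    generalize letter k m = a at *
    generalize letter k (m + 1) = b at *
    have hle : a / k ≤ (a + 1) / k := Nat.div_le_div_right (by omega)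
    by_cases hs : b % k = k - 1
    · have hb1 : (b + 1) / k = b / k + 1 := by
        have := Nat.div_add_mod b k
        rw [show b + 1 = k * (b / k + 1) by rw [Nat.mul_add]; omega, Nat.mul_div_cancel_left _ hk0]
      by_cases hlt : a / k < b / k
      · have := (ih hlt).1
        rw [this, Nat.mul_mod_right] at hs
        omega
      · by_cases ha : a % k = k - 1
        · have : (a + 1) / k = a / k + 1 := by
            have := Nat.div_add_mod a k
            rw [show a + 1 = k * (a / k + 1) by rw [Nat.mul_add]; omega,
              Nat.mul_div_cancel_left _ hk0]
          omega
        · have := succ_mod_of_double hk ha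
          refine ⟨?_, by omega⟩
          congr 1
          omega
    · have hb1 := (succ_mod_of_double hk hs).2
      have hlt : a / k < b / k := by omega
      have h1 := (ih hlt).1
      have h2 : b / k = a / k + 1 := by rw [h1, Nat.mul_div_cancel_left _ hk0]
      have ha : a % k ≠ k - 1 := by
        intro ha
        have : (a + 1) / k = a / k + 1 := by
          have := Nat.div_add_mod a k
          rw [show a + 1 = k * (a / k + 1) by rw [Nat.mul_add]; omega,
            Nat.mul_div_cancel_left _ hk0]
        omega
      have := succ_mod_of_double hk ha
      refine ⟨?_, by omega⟩
      congr 1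
      omega

theorem eq_of_image_eq {k a b : ℕ} (hk : 2 ≤ k) (h0 : letter k (pos k a) = letter k (pos k b))
    (h1 : letter k (pos k a + 1) = letter k (pos k b + 1)) : letter k a = letter k b := by
  have key : ∀ a b : ℕ, letter k a % k = k - 1 → letter k b % k ≠ k - 1 →
      letter k (pos k a + 1) ≠ letter k (pos k b + 1) := by
    intro a b ha hb h
    have h2 := letter_pos_mod hk (a + 1)
    rw [(image_single hk ha).1, h, (image_double hk hb).2.2, (succ_mod_of_double hk hb).1] at h2
    omega
  by_cases ha : letter k a % k = k - 1 <;> by_cases hb : letter k b % k = k - 1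
  · rw [(image_single hk ha).2, (image_single hk hb).2] at h0
    omega
  · exact absurd h1 (key a b ha hb)
  · exact absurd h1.symm (key b a hb ha)
  · rw [(image_double hk ha).2.2, (image_double hk hb).2.2] at h1
    omega

theorem pos_add_sub_pos {k p s M m : ℕ} (hp : ∀ i, s ≤ i → i < M → letter k i = letter k (i + p))
    (hs : s ≤ m) (hm : m ≤ M) : pos k (m + p) + pos k s = pos k m + pos k (s + p) := by
  induction m, hs using Nat.le_induction with
  | base => omega
  | succ m hs ih =>
    have h := hp m hs (by omega)
    have h1 := pos_add k m 1
    have h2 := pos_add k (m + p) 1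
    rw [seg_one, ← h] at h2
    rw [seg_one] at h1
    rw [show m + 1 + p = m + p + 1 by omega]
    have := ih (by omega)
    omega

/-- A square either has the form `aa` with `a` divisible by `k`, or it is covered by the image of a
shorter or earlier square. -/
theorem square_desubstitution {k s p : ℕ} (hk : 3 ≤ k) (hp : 0 < p)
    (h : ∀ i, s ≤ i → i < s + p → letter k i = letter k (i + p)) :
    ∃ m p', 0 < p' ∧ pos k m ≤ s ∧ s ≤ pos k m + 1 ∧ letter k (pos k m) = letter k (pos k m + p) ∧
      pos k (m + p') = pos k m + p ∧
      ((∀ i, m ≤ i → i < m + p' → letter k i = letter k (i + p')) ∨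
        (p = 1 ∧ ∃ q, letter k (pos k m) = k * q ∧ letter k (pos k m + 1) = k * q ∧
          letter k (pos k m + 2) = k * q + 1)) := by
  have hk2 : 2 ≤ k := by omega
  have hk0 : 0 < k := by omega
  obtain ⟨m, hms, hsm, h⟩ : ∃ m, pos k m ≤ s ∧ s ≤ pos k m + 1 ∧
      ∀ i, pos k m ≤ i → i < pos k m + p → letter k i = letter k (i + p) := by
    obtain ⟨m, rfl | ⟨rfl, hm⟩⟩ := exists_pos hk2 s
    · exact ⟨m, le_rfl, by omega, h⟩
    · refine ⟨m, by omega, le_rfl, fun i h1 h2 => ?_⟩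
      rcases h1.lt_or_eq with h1 | rfl
      · exact h i h1 (by omega)
      have h3 := h (pos k m + 1) le_rfl (by omega)
      have h4 := (image_double hk2 hm).2.2
      have h5 := succ_mod_of_double hk2 hm
      have h6 : letter k (pos k m + 1) % k ≠ 0 := by rw [h4]; omega
      rw [letter_eq_of_succ_mod_ne_zero hk2 h6]
      rw [show pos k m + 1 + p = pos k m + p + 1 by omega] at h3
      rw [h3] at h6 ⊢
      rw [letter_eq_of_succ_mod_ne_zero hk2 h6]
  obtain ⟨m2, hm2⟩ : ∃ m2, pos k m + p = pos k m2 := by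
    apply exists_eq_pos_of_mod_eq_zero hk2
    rw [← h _ le_rfl (by omega), letter_pos_mod hk2]
  have hlt : m < m2 := (pos_strictMono k).lt_iff_lt.1 (by omega)
  obtain ⟨p', rfl⟩ := Nat.exists_eq_add_of_lt hlt
  rw [Nat.add_assoc] at hm2
  refine ⟨m, p' + 1, by omega, hms, hsm, h _ le_rfl (by omega), hm2.symm, ?_⟩
  rw [or_iff_not_imp_right]
  intro hbase
  have step : ∀ j, j ≤ p' → (∀ i, m ≤ i → i < m + j → letter k i = letter k (i + (p' + 1))) →
      letter k (m + j) = letter k (m + j + (p' + 1)) := by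
    intro j hj hi
    have hpos := pos_add_sub_pos hi (Nat.le_add_right m j) le_rfl
    have hlt1 : pos k (m + j) < pos k (m + (p' + 1)) := pos_strictMono k (by omega)
    have hpj : pos k (m + j + (p' + 1)) = pos k (m + j) + p := by omega
    have h0 := h (pos k (m + j)) (pos_mono k (by omega)) (by omega)
    rw [← hpj] at h0
    by_cases hin : pos k (m + j) + 1 < pos k m + p
    · have h1 := h (pos k (m + j) + 1) (by have := pos_mono k (Nat.le_add_right m j); omega) hin
      rw [show pos k (m + j) + 1 + p = pos k (m + j + (p' + 1)) + 1 by omega] at h1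
      exact eq_of_image_eq hk2 h0 h1
    have hend : pos k (m + j) + 1 = pos k (m + (p' + 1)) := by omega
    have ha : letter k (m + j) % k = k - 1 := by
      by_contra ha
      have h1 := (image_double hk2 ha).2.2
      have h2 := succ_mod_of_double hk2 ha
      have h3 := letter_pos_mod hk2 (m + (p' + 1))
      rw [← hend, h1] at h3
      omega
    have hjp : j = p' := by
      have := (image_single hk2 ha).1
      have : m + j + 1 = m + (p' + 1) := (pos_strictMono k).injective (by omega)
      omega
    subst hjp
    by_cases hb : letter k (m + j + (j + 1)) % k = k - 1
    · rw [(image_single hk2 ha).2, (image_single hk2 hb).2] at h0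
      omega
    exfalso
    have hQ : letter k (m + j) / k < letter k (m + j + (j + 1)) / k := by
      rw [(image_single hk2 ha).2, (image_double hk2 hb).2.1] at h0
      by_contra hle
      have h1 := Nat.mul_le_mul_left k (not_lt.1 hle)
      have h2 := Nat.mul_div_le (letter k (m + j)) k
      omega
    cases j with
    | zero =>
      have hb0 : letter k (m + 0 + (0 + 1)) % k = 0 := by
        by_contra hne
        have := letter_eq_of_succ_mod_ne_zero hk2 hne
        rw [Nat.add_zero, this, Nat.mul_mod_right] at ha
        omega
      have hb1 := image_double hk2 hb
      have hsa := image_single hk2 ha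
      simp only [Nat.add_zero, Nat.zero_add] at *
      have hp1 : p = 1 := by omega
      subst hp1
      apply hbase
      refine ⟨rfl, letter k (m + 1) / k, ?_, ?_, ?_⟩
      · rw [h0, hb1.2.1]
      · rw [← hb1.2.1, hm2]
      · rw [show pos k m + 2 = pos k (m + 1) + 1 by omega, hb1.2.2]
        have := Nat.div_add_mod (letter k (m + 1)) k
        omega
    | succ j =>
      have h1 := hi (m + j) (by omega) (by omega)
      have h2 : letter k (m + j) = k * (letter k (m + (j + 1)) / k) :=
        letter_eq_of_succ_mod_ne_zero hk2 (by rw [Nat.add_assoc, ha]; omega)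
      have h3 := (level_succ hk2 (m + j + (j + 1 + 1)) (by
        rw [← h1, h2, Nat.mul_div_cancel_left _ hk0]
        rwa [show m + j + (j + 1 + 1) + 1 = m + (j + 1) + (j + 1 + 1) by omega])).2
      rw [← h1, h2, Nat.mul_mod_right] at h3
      exact h3 rfl
  have all : ∀ j, j ≤ p' + 1 → ∀ i, m ≤ i → i < m + j → letter k i = letter k (i + (p' + 1)) := by
    intro j
    induction j with
    | zero => intro _ i _ _; omega
    | succ j ih =>
      intro hj i h1 h2
      rcases Nat.lt_or_ge i (m + j) with h3 | h3
      · exact ih (by omega) i h1 h3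
      · obtain rfl : i = m + j := by omega
        exact step j (by omega) (ih (by omega))
  exact all _ le_rfl

/-- The word by which the maximal repetition with period word `W k n` prolongs the square. -/
def excess (k : ℕ) : ℕ → List ℕ
  | 0 => []
  | n + 1 => phiW k (excess k n) ++ if n + 2 < k then [0] else []

/-- The suffix of `W k n` that remains after removing the prefix `excess k n`. -/
def remainder (k : ℕ) : ℕ → List ℕ
  | 0 => [0]
  | n + 1 => if n + 2 < k then [n + 1] else phiW k (remainder k n)

theorem remainder_of_le {k n : ℕ} (h : n + 2 ≤ k) : remainder k n = [n] := by
  cases n with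
  | zero => rfl
  | succ n => rw [remainder, if_pos (by omega)]

theorem remainder_succ_of_le {k n : ℕ} (h : k ≤ n + 2) :
    remainder k (n + 1) = phiW k (remainder k n) := by
  rw [remainder, if_neg (by omega)]

theorem phiW_small {k a : ℕ} (h : a + 2 ≤ k) : phiW k [a] = [0, a + 1] := by
  rw [phiW_double (by rw [Nat.mod_eq_of_lt (by omega)]; omega), Nat.div_eq_of_lt (by omega),
    Nat.mul_zero]

theorem excess_append_remainder (k n : ℕ) :
    excess k n ++ remainder k n = W k n := by
  induction n with
  | zero => rfl
  | succ n ih =>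
    rw [W_succ, ← ih, phiW_append, excess]
    by_cases h : n + 2 < k
    · rw [if_pos h, remainder_of_le (by omega), remainder_of_le (by omega), phiW_small (by omega)]
      simp
    · rw [if_neg h, remainder_succ_of_le (by omega), List.append_nil]

theorem remainder_eq_zero_cons {k n : ℕ} (hk : 2 ≤ k) (h : k ≤ n + 1) :
    ∃ t, remainder k n = 0 :: t := by
  induction n with
  | zero => omega
  | succ n ih =>
    rw [remainder_succ_of_le h]
    rcases h.lt_or_eq with h | h
    · obtain ⟨t, ht⟩ := ih (by omega)
      exact ⟨_, by rw [ht, phiW_zero_cons hk]⟩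
    · exact ⟨_, by rw [remainder_of_le (by omega), phiW_small (by omega)]⟩

/-- A maximal repetition of the infinite word, starting at position `s`, whose period word is
`W k n` shifted by `k * q`. -/
structure MaximalRun (k n q s : ℕ) : Prop where
  seg_eq : seg k s (2 * (W k n).length + (excess k n).length) =
    (W k n ++ W k n ++ excess k n).map (· + k * q)
  next_eq : letter k (s + (2 * (W k n).length + (excess k n).length)) =
    if n + 2 ≤ k then k * q + n + 1 else k * (q + 1)

theorem MaximalRun.succ {k n q s : ℕ} (hk : 2 ≤ k) (h : MaximalRun k n q s) :
    MaximalRun k (n + 1) q (pos k s) ∧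
      pos k (s + (2 * (W k n).length + (excess k n).length)) ≤
        pos k s + (2 * (W k (n + 1)).length + (excess k (n + 1)).length) := by
  obtain ⟨h1, h2⟩ := h
  set L := 2 * (W k n).length + (excess k n).length with hL
  have hk0 : 0 < k := by omega
  have himg : phiW k (seg k s L) =
      (W k (n + 1) ++ W k (n + 1) ++ phiW k (excess k n)).map (· + k * q) := by
    rw [h1, phiW_map_add hk0, phiW_append, phiW_append, W_succ]
  have hlen : (phiW k (seg k s L)).length =
      2 * (W k (n + 1)).length + (phiW k (excess k n)).length := by
    rw [himg]; simp; ring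
  have hpos : pos k (s + L) =
      pos k s + (2 * (W k (n + 1)).length + (phiW k (excess k n)).length) := by
    rw [pos_add, hlen]
  have hseg := phiW_seg hk s L
  rw [himg, ← himg, hlen, himg] at hseg
  by_cases hn : n + 2 < k
  · have he : excess k (n + 1) = phiW k (excess k n) ++ [0] := by rw [excess, if_pos hn]
    rw [if_pos (by omega)] at h2
    have hm : (k * q + n + 1) % k = n + 1 := by
      rw [Nat.add_assoc, Nat.mul_add_mod, Nat.mod_eq_of_lt (by omega)]
    have hd : (k * q + n + 1) / k = q := by
      rw [Nat.add_assoc, Nat.mul_add_div hk0, Nat.div_eq_of_lt (by omega), Nat.add_zero]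
    have h3 := image_double (m := s + L) hk (by rw [h2, hm]; omega)
    rw [h2, hd] at h3
    refine ⟨⟨?_, ?_⟩, ?_⟩
    · rw [he, List.length_append, List.length_singleton, ← Nat.add_assoc, seg_add, ← hseg, ← hpos,
        seg_one, h3.2.1]
      simp
    · rw [he, List.length_append, List.length_singleton, ← Nat.add_assoc (2 * _), ← Nat.add_assoc,
        ← hpos, h3.2.2, if_pos (by omega)]
      omega
    · rw [he, List.length_append, hpos]
      omega
  · have he : excess k (n + 1) = phiW k (excess k n) := by
      rw [excess, if_neg hn, List.append_nil]
    refine ⟨⟨?_, ?_⟩, ?_⟩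
    · rw [he, ← hseg]
    · rw [he, ← hpos, if_neg (by omega), letter_pos hk, h2]
      congr 1
      split_ifs with h3
      · rw [show k * q + n + 1 + 1 = k * (q + 1) by rw [Nat.mul_add]; omega,
          Nat.mul_div_cancel_left _ hk0]
      · rw [Nat.mul_add_div hk0, Nat.div_eq_of_lt (by omega), Nat.add_zero]
    · rw [he, hpos]

theorem MaximalRun.letter_eq {k n q s i : ℕ} (h : MaximalRun k n q s)
    (hi : i < 2 * (W k n).length + (excess k n).length) :
    some (letter k (s + i)) = ((W k n ++ W k n ++ excess k n)[i]?).map (· + k * q) := by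
  rw [← getElem?_seg hi, h.seg_eq, List.getElem?_map]

theorem MaximalRun.periodic {k n q s : ℕ} (h : MaximalRun k n q s) {i : ℕ}
    (h1 : s ≤ i) (h2 : i < s + ((W k n).length + (excess k n).length)) :
    letter k i = letter k (i + (W k n).length) := by
  obtain ⟨j, rfl⟩ := Nat.exists_eq_add_of_le h1
  have h3 := h.letter_eq (i := j) (by omega)
  have h4 := h.letter_eq (i := j + (W k n).length) (by omega)
  rw [← Nat.add_assoc] at h4
  apply Option.some_injective
  rw [h3, h4]
  congr 1
  rw [List.append_assoc, List.getElem?_append_right (by omega : (W k n).length ≤ j + _),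
    Nat.add_sub_cancel, ← List.append_assoc]
  nth_rewrite 2 [← excess_append_remainder k n]
  rw [← List.append_assoc, List.append_assoc, List.getElem?_append_left]
  rw [List.length_append]
  omega

theorem length_remainder_pos {k : ℕ} (hk : 2 ≤ k) (n : ℕ) : 0 < (remainder k n).length := by
  rcases le_or_gt (n + 2) k with h | h
  · simp [remainder_of_le h]
  · obtain ⟨t, ht⟩ := remainder_eq_zero_cons (k := k) (n := n) hk (by omega)
    simp [ht]

theorem MaximalRun.mismatch {k n q s : ℕ} (hk : 2 ≤ k) (h : MaximalRun k n q s) :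
    letter k (s + ((W k n).length + (excess k n).length)) ≠
      letter k (s + ((W k n).length + (excess k n).length) + (W k n).length) := by
  have hr := length_remainder_pos hk n
  have hl := congrArg List.length (excess_append_remainder k n)
  rw [List.length_append] at hl
  have h3 := h.letter_eq (i := (W k n).length + (excess k n).length) (by omega)
  rw [List.append_assoc, List.getElem?_append_right (by omega), Nat.add_sub_cancel_left,
    List.getElem?_append_left (by omega), ← excess_append_remainder k n,
    List.getElem?_append_right le_rfl, Nat.sub_self, excess_append_remainder k n] at h3
  have h4 := h.next_eq
  rw [show s + (2 * (W k n).length + (excess k n).length) =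
    s + ((W k n).length + (excess k n).length) + (W k n).length by omega] at h4
  rw [h4]
  split_ifs with hn
  · rw [remainder_of_le hn] at h3
    simp at h3
    omega
  · obtain ⟨t, ht⟩ := remainder_eq_zero_cons (k := k) (n := n) hk (by omega)
    rw [ht] at h3
    simp at h3
    rw [h3, Nat.mul_add]
    omega

theorem exists_maximalRun_of_square {k : ℕ} (hk : 3 ≤ k) {s p : ℕ} (hp : 0 < p)
    (h : ∀ i, s ≤ i → i < s + p → letter k i = letter k (i + p)) :
    ∃ n q t, p = (W k n).length ∧ MaximalRun k n q t ∧ t ≤ s ∧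
      s ≤ t + ((W k n).length + (excess k n).length) := by
  have hk2 : 2 ≤ k := by omega
  induction hN : s + p using Nat.strong_induction_on generalizing s p with
  | _ N ih =>
    obtain ⟨m, p', hp', hms, hsm, hmm, hend, hd⟩ := square_desubstitution hk hp h
    rcases hd with hd | ⟨rfl, q, h0, h1, h2⟩
    · have hlt := lt_pos hk2 (by omega : 0 < m + p')
      obtain ⟨n, q, t, rfl, hrun, htm, hmt⟩ := ih (m + p') (by omega) hp' hd rfl
      obtain ⟨hrun', hle⟩ := hrun.succ hk2
      have hdiff := pos_add_sub_pos (fun i => hrun.periodic) htm hmt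
      have hfirst : pos k (t + (W k n).length) = pos k t + (W k (n + 1)).length := by
        have h3 := hrun.seg_eq
        rw [show 2 * (W k n).length + (excess k n).length =
          (W k n).length + ((W k n).length + (excess k n).length) by omega, seg_add,
          List.append_assoc, List.map_append] at h3
        have h4 := (List.append_inj h3 (by simp)).1
        rw [pos_add, h4, phiW_map_add (by omega), List.length_map, W_succ]
      have hmono := pos_mono k htm
      have hmono' := pos_mono k (by omega : m + (W k n).length ≤
        t + (2 * (W k n).length + (excess k n).length))
      have hpe : p = (W k (n + 1)).length := by omega
      refine ⟨n + 1, q, pos k t, hpe, hrun', by omega, ?_⟩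
      by_contra hcon
      apply hrun'.mismatch hk2
      rw [show pos k t + ((W k (n + 1)).length + (excess k (n + 1)).length) = pos k m by omega,
        ← hpe]
      exact hmm
    · refine ⟨0, q, pos k m, rfl, ⟨?_, ?_⟩, hms, ?_⟩
      · simp [W_zero, excess, seg_two, h0, h1]
      · simp only [W_zero, excess, List.length_cons, List.length_nil]
        rw [if_pos (by omega)]
        exact h2
      · simpa [W_zero, excess] using hsm

/-- The length of the `n`-fold image of the letter `a`. -/
def iterLen (k a n : ℕ) : ℕ := ((phiW k)^[n] [a]).length

theorem iterLen_zero_letter (k n : ℕ) : iterLen k 0 n = (W k n).length := rfl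

theorem iterate_phiW_append (k n : ℕ) (u v : List ℕ) :
    (phiW k)^[n] (u ++ v) = (phiW k)^[n] u ++ (phiW k)^[n] v := by
  induction n generalizing u v with
  | zero => rfl
  | succ n ih => rw [Function.iterate_succ_apply, phiW_append, ih]; rfl

theorem iterLen_succ {k a : ℕ} (n : ℕ) (h : a + 2 ≤ k) :
    iterLen k a (n + 1) = (W k n).length + iterLen k (a + 1) n := by
  rw [iterLen, Function.iterate_succ_apply, phiW_small h, ← List.singleton_append,
    iterate_phiW_append, List.length_append]
  rfl

theorem iterate_phiW_map_add {k : ℕ} (hk : 0 < k) (n q : ℕ) (u : List ℕ) :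
    (phiW k)^[n] (u.map (· + k * q)) = ((phiW k)^[n] u).map (· + k * q) := by
  induction n generalizing u with
  | zero => rfl
  | succ n ih => rw [Function.iterate_succ_apply, phiW_map_add hk, ih]; rfl

theorem iterLen_pred {k : ℕ} (hk : 2 ≤ k) (n : ℕ) :
    iterLen k (k - 1) (n + 1) = (W k n).length := by
  have h : phiW k [k - 1] = [0].map (· + k * 1) := by
    rw [phiW_single (Nat.mod_eq_of_lt (by omega))]
    simp
    omega
  rw [iterLen, Function.iterate_succ_apply, h, iterate_phiW_map_add (by omega), List.length_map]
  rfl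

theorem iterLen_eq_two_pow {k : ℕ} (n a : ℕ) (h : a + n + 1 ≤ k) : iterLen k a n = 2 ^ n := by
  induction n generalizing a with
  | zero => rfl
  | succ n ih =>
    rw [iterLen_succ n (by omega), ih (a + 1) (by omega), ← iterLen_zero_letter,
      ih 0 (by omega)]
    ring

theorem length_W_add_le (k m i : ℕ) : (W k (m + i)).length ≤ 2 ^ i * (W k m).length := by
  induction i with
  | zero => simp
  | succ i ih =>
    rw [← Nat.add_assoc, W_succ, pow_succ]
    have := length_phiW_le k (W k (m + i))
    linarith

theorem iterLen_le {k : ℕ} (hk : 2 ≤ k) (j i : ℕ) (hi : i + 1 ≤ k) :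
    iterLen k (k - 1 - i) (j + 1 + i) + (W k (j + 1)).length ≤
      2 ^ i * (W k (j + 1)).length + (W k j).length := by
  induction i with
  | zero => rw [Nat.sub_zero, Nat.add_zero, iterLen_pred hk]; omega
  | succ i ih =>
    rw [← Nat.add_assoc, iterLen_succ _ (by omega),
      show k - 1 - (i + 1) + 1 = k - 1 - i by omega, pow_succ]
    have := length_W_add_le k (j + 1) i
    have := ih (by omega)
    linarith

theorem iterLen_one_add {k : ℕ} (hk : 2 ≤ k) (i : ℕ) (hi : i + 1 ≤ k) :
    iterLen k (k - 1 - i) (1 + i) + 1 = 2 ^ (i + 1) := by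
  induction i with
  | zero => exact congrArg (· + 1) (iterLen_pred hk 0)
  | succ i ih =>
    rw [← Nat.add_assoc, iterLen_succ _ (by omega),
      show k - 1 - (i + 1) + 1 = k - 1 - i by omega, ← iterLen_zero_letter,
      iterLen_eq_two_pow (1 + i) 0 (by omega), pow_succ, ← ih (by omega), Nat.add_comm 1 i]
    have := ih (by omega)
    rw [Nat.add_comm 1 i] at this
    omega

theorem length_W_self {k : ℕ} (hk : 2 ≤ k) : (W k k).length + 1 = 2 ^ k := by
  have h := iterLen_one_add hk (k - 1) (by omega)
  rwa [Nat.sub_self, show 1 + (k - 1) = k by omega, Nat.sub_add_cancel (by omega)] at h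

theorem remainder_eq_iterate {k : ℕ} (hk : 2 ≤ k) (j : ℕ) :
    remainder k (k - 2 + j) = (phiW k)^[j] [k - 2] := by
  induction j with
  | zero => rw [Nat.add_zero, remainder_of_le (by omega)]; rfl
  | succ j ih =>
    rw [← Nat.add_assoc, remainder_succ_of_le (by omega), ih, Function.iterate_succ_apply']

theorem length_remainder_add {k : ℕ} (hk : 2 ≤ k) (j : ℕ) :
    (remainder k (k + j)).length = (W k (j + 1)).length + (W k j).length := by
  rw [show k + j = k - 2 + (j + 2) by omega, remainder_eq_iterate hk]
  have h := iterLen_succ (k := k) (a := k - 2) (j + 1) (by omega)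
  rwa [show k - 2 + 1 = k - 1 by omega, iterLen_pred hk] at h

theorem three_mul_length_W_le {k : ℕ} (hk : 3 ≤ k) (n : ℕ) :
    3 * (W k n).length + (remainder k n).length ≤ 2 ^ k * (remainder k n).length := by
  have hk2 : 2 ≤ k := by omega
  rcases Nat.lt_or_ge n k with hn | hn
  · have hW := iterLen_eq_two_pow (k := k) n 0 (by omega)
    rw [iterLen_zero_letter] at hW
    rw [hW]
    by_cases h2 : n + 2 ≤ k
    · rw [remainder_of_le h2, List.length_singleton, mul_one]
      have h3 : 2 ^ (n + 2) ≤ 2 ^ k := Nat.pow_le_pow_right (by norm_num) h2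
      have h4 : 1 ≤ 2 ^ n := Nat.one_le_two_pow
      rw [pow_add] at h3
      omega
    · have hr := iterLen_eq_two_pow (k := k) 1 (k - 2) (by omega)
      rw [iterLen, ← remainder_eq_iterate hk2] at hr
      rw [show n = k - 2 + 1 by omega, hr]
      obtain ⟨d, rfl⟩ := Nat.exists_eq_add_of_le hk
      have h4 : 1 ≤ 2 ^ d := Nat.one_le_two_pow
      rw [show 3 + d - 2 + 1 = d + 2 by omega, show 3 + d = d + 3 by omega, pow_add, pow_add]
      omega
  · obtain ⟨j, rfl⟩ := Nat.exists_eq_add_of_le hn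
    rw [length_remainder_add hk2]
    have h1 := iterLen_le hk2 j (k - 1) (by omega)
    rw [Nat.sub_self, show j + 1 + (k - 1) = k + j by omega, iterLen_zero_letter] at h1
    have h2 := length_W_add_le k j 1
    obtain ⟨d, rfl⟩ := Nat.exists_eq_add_of_le hk
    have h4 : 1 ≤ 2 ^ d := Nat.one_le_two_pow
    rw [show 3 + d - 1 = d + 2 by omega, pow_add] at h1
    rw [show (2 : ℕ) ^ (3 + d) = 2 ^ d * 8 by rw [pow_add]; ring]
    nlinarith

theorem length_W_eq (k n : ℕ) :
    (W k n).length = (excess k n).length + (remainder k n).length := by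
  rw [← List.length_append, excess_append_remainder]

theorem length_excess_self {k : ℕ} (hk : 2 ≤ k) : (excess k k).length + 3 = (W k k).length := by
  have h := length_remainder_add hk 0
  have h1 : (W k 1).length = 2 := by
    rw [← iterLen_zero_letter, iterLen_eq_two_pow 1 0 (by omega)]; rfl
  rw [Nat.add_zero, Nat.zero_add, h1, W_zero, List.length_singleton] at h
  rw [length_W_eq, h]

theorem exists_letter_eq {k : ℕ} (hk : 2 ≤ k) {j : ℕ} (hj : j + 1 < k) :
    ∃ i, letter k i = 0 ∧ letter k (i + 1) = j + 1 := by
  have key : ∀ j m, j + 1 < k → letter k m = j →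
      ∃ i, letter k i = 0 ∧ letter k (i + 1) = j + 1 := by
    intro j m hj hm
    have h := image_double (m := m) hk (by rw [hm, Nat.mod_eq_of_lt (by omega)]; omega)
    rw [hm, Nat.div_eq_of_lt (by omega), Nat.mul_zero] at h
    exact ⟨_, h.2⟩
  induction j with
  | zero => exact key 0 0 hj rfl
  | succ j ih =>
    obtain ⟨m, -, hm⟩ := ih (by omega)
    exact key _ _ hj hm

theorem exists_letter_eq_self {k : ℕ} (hk : 2 ≤ k) {j : ℕ} (hj : 1 ≤ j) (hjk : j ≤ k) :
    ∃ i, letter k i = j ∧ letter k (i + 1) = k := by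
  induction j, hj using Nat.le_induction with
  | base =>
    obtain ⟨m, h0, h1⟩ := exists_letter_eq (k := k) (j := k - 2) hk (by omega)
    have h := image_double (m := m) hk (by rw [h0, Nat.zero_mod]; omega)
    have h' := image_single (m := m + 1) hk (by rw [h1, Nat.mod_eq_of_lt] <;> omega)
    refine ⟨pos k m + 1, by rw [h.2.2, h0], ?_⟩
    rw [show pos k m + 1 + 1 = pos k (m + 1) by omega, h'.2, h1]
    omega
  | succ j hj ih =>
    obtain ⟨m, h0, h1⟩ := ih (by omega)
    have h' := (image_double (m := m + 1) hk (by rw [h1, Nat.mod_self]; omega)).2.1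
    rw [h1, Nat.div_self (by omega), mul_one] at h'
    by_cases hs : letter k m % k = k - 1
    · have h := image_single hk hs
      exact ⟨pos k m, by rw [h.2, h0], by rw [← h.1, h']⟩
    · have h := image_double hk hs
      exact ⟨pos k m + 1, by rw [h.2.2, h0], by rw [Nat.add_assoc, ← h.1, h']⟩

theorem exists_maximalRun {k : ℕ} (hk : 2 ≤ k) (n : ℕ) : ∃ s, MaximalRun k n 1 s := by
  induction n with
  | zero =>
    obtain ⟨m, h0, h1⟩ := exists_letter_eq_self (k := k) (j := k - 1) hk (by omega) (by omega)
    have h := image_single (m := m) hk (by rw [h0, Nat.mod_eq_of_lt]; omega)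
    have h' := image_double (m := m + 1) hk (by rw [h1, Nat.mod_self]; omega)
    rw [h1, Nat.div_self (by omega), h.1] at h'
    rw [h0] at h
    refine ⟨pos k m, ⟨?_, ?_⟩⟩
    · simp [W_zero, excess, seg_two, h.2, h'.2.1]
      omega
    · simp only [W_zero, excess, List.length_cons, List.length_nil]
      rw [if_pos (by omega)]
      exact h'.2.2.trans (by omega)
  | succ n ih =>
    obtain ⟨s, hs⟩ := ih
    exact ⟨_, (hs.succ hk).1⟩

theorem getElem?_take_flatten_replicate (U : List ℕ) (hU : U ≠ []) {L i : ℕ}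
    (h : i + U.length < L) :
    (((List.replicate L U).flatten).take L)[i]? =
      (((List.replicate L U).flatten).take L)[i + U.length]? := by
  obtain ⟨M, rfl⟩ : ∃ M, L = M + 1 := ⟨L - 1, by omega⟩
  have hU' : 1 ≤ U.length := List.length_pos_of_ne_nil hU
  rw [List.getElem?_take_of_lt (by omega), List.getElem?_take_of_lt h]
  conv_rhs => rw [List.replicate_succ, List.flatten_cons,
    List.getElem?_append_right (by omega), Nat.add_sub_cancel]
  rw [List.replicate_succ', List.flatten_append, List.getElem?_append_left]
  simp only [List.length_flatten, List.map_replicate, List.sum_replicate, smul_eq_mul]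
  nlinarith

theorem length_le_of_infix_W {k : ℕ} (hk : 3 ≤ k) {U : List ℕ} (hU : U ≠ []) {L n : ℕ}
    (hL : 2 * U.length ≤ L) (h : ((List.replicate L U).flatten).take L <:+: W k n) :
    ∃ m, U.length = (W k m).length ∧ L ≤ 2 * (W k m).length + (excess k m).length := by
  have hk2 : 2 ≤ k := by omega
  have hU' : 1 ≤ U.length := List.length_pos_of_ne_nil hU
  obtain ⟨u, v, huv⟩ := h
  have hlen : (((List.replicate L U).flatten).take L).length = L := by
    rw [List.length_take, List.length_flatten, List.map_replicate, List.sum_replicate, smul_eq_mul]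
    exact min_eq_left (Nat.le_mul_of_pos_right _ hU')
  have hfac : ∀ i, i < L →
      some (letter k (u.length + i)) = (((List.replicate L U).flatten).take L)[i]? := by
    intro i hi
    have h1 := congrArg List.length huv
    rw [List.length_append, List.length_append, hlen] at h1
    have h2 := getElem?_seg (k := k) (s := 0) (l := (W k n).length) (i := u.length + i) (by omega)
    rw [← W_eq_seg hk2, ← huv, List.append_assoc, List.getElem?_append_right (by omega),
      Nat.add_sub_cancel_left, List.getElem?_append_left (by omega), Nat.zero_add] at h2
    exact h2.symm
  have hper : ∀ i, u.length ≤ i → i + U.length < u.length + L →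
      letter k i = letter k (i + U.length) := by
    intro i h1 h2
    obtain ⟨j, rfl⟩ := Nat.exists_eq_add_of_le h1
    apply Option.some_injective
    rw [Nat.add_assoc, hfac j (by omega), hfac (j + U.length) (by omega)]
    exact getElem?_take_flatten_replicate U hU (by omega)
  obtain ⟨m, q, t, hm, hrun, hts, hst⟩ := exists_maximalRun_of_square hk hU'
    fun i h1 h2 => hper i h1 (by omega)
  refine ⟨m, hm, ?_⟩
  by_contra hcon
  apply hrun.mismatch hk2
  rw [← hm]
  exact hper _ (by omega) (by omega)

theorem exists_infix_W {k : ℕ} (hk : 2 ≤ k) :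
    ∃ U : List ℕ, U.length = (W k k).length ∧
      ∃ n, ((List.replicate (2 * (W k k).length + (excess k k).length) U).flatten).take
        (2 * (W k k).length + (excess k k).length) <:+: W k n := by
  obtain ⟨s, hs⟩ := exists_maximalRun hk k
  refine ⟨(W k k).map (· + k * 1), by simp,
    s + (2 * (W k k).length + (excess k k).length), ?_⟩
  have h := seg_infix_W hk s (2 * (W k k).length + (excess k k).length)
  rw [hs.seg_eq] at h
  convert h using 1
  have h3 := length_excess_self hk
  obtain ⟨d, hd⟩ : ∃ d, 2 * (W k k).length + (excess k k).length = d + 3 :=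
    ⟨2 * (W k k).length + (excess k k).length - 3, by omega⟩
  have hW := congrArg (List.map (· + k * 1)) (excess_append_remainder k k)
  rw [hd, List.replicate_succ, List.replicate_succ, List.replicate_succ, ← hd]
  simp only [List.flatten_cons]
  nth_rewrite 3 [← hW]
  rw [List.map_append, List.append_assoc (List.map _ (excess k k)), ← List.append_assoc,
    ← List.append_assoc, List.take_left']
  · simp
  · simp; ring

theorem critical_exponent_W (k : ℕ) (hk : 3 ≤ k) :
    sSup {r : ℝ | ∃ (U : List ℕ) (L : ℕ), U ≠ [] ∧ r = (L : ℝ) / U.length ∧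
        ∃ n, ((List.replicate L U).flatten).take L <:+: W k n} =
      3 - 3 / (2 ^ k - 1) := by
  have hk2 : 2 ≤ k := by omega
  have h8 : (8 : ℝ) ≤ 2 ^ k := by
    have : 2 ^ 3 ≤ 2 ^ k := Nat.pow_le_pow_right (by norm_num) hk
    exact_mod_cast this
  have hden : (0 : ℝ) < 2 ^ k - 1 := by linarith
  apply IsGreatest.csSup_eq
  constructor
  · obtain ⟨U, hU, n, hn⟩ := exists_infix_W hk2
    have h1 := length_W_self hk2
    have h2 := length_excess_self hk2
    refine ⟨U, _, ?_, ?_, n, hn⟩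
    · rintro rfl
      rw [List.length_nil] at hU
      omega
    · have h1' : ((W k k).length : ℝ) = 2 ^ k - 1 := by
        rw [eq_sub_iff_add_eq]; exact_mod_cast h1
      have h2' : ((excess k k).length : ℝ) = (W k k).length - 3 := by
        rw [eq_sub_iff_add_eq]; exact_mod_cast h2
      rw [hU]
      push_cast
      rw [h2', h1']
      field_simp
      ring
  · rintro r ⟨U, L, hU, rfl, n, hn⟩
    have hU' : (0 : ℝ) < U.length := by exact_mod_cast List.length_pos_of_ne_nil hU
    have h3 : (3 : ℝ) / (2 ^ k - 1) ≤ 1 := by rw [div_le_one hden]; linarith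
    rcases Nat.lt_or_ge L (2 * U.length) with hL | hL
    · have : (L : ℝ) < 2 * U.length := by exact_mod_cast hL
      have : (L : ℝ) / U.length < 2 := by rwa [div_lt_iff₀ hU']
      linarith
    · obtain ⟨m, hm, hLm⟩ := length_le_of_infix_W hk hU hL hn
      have h4 := three_mul_length_W_le hk m
      have h5 := length_W_eq k m
      rw [← hm] at h4 h5 hLm
      have h4' : 3 * (U.length : ℝ) + (remainder k m).length ≤
        2 ^ k * (remainder k m).length := by exact_mod_cast h4
      have h5' : (U.length : ℝ) = (excess k m).length + (remainder k m).length := by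
        exact_mod_cast h5
      have hL' : (L : ℝ) ≤ 2 * U.length + (excess k m).length := by exact_mod_cast hLm
      have h6 : 3 / (2 ^ k - 1) * (U.length : ℝ) ≤ (remainder k m).length := by
        rw [div_mul_eq_mul_div, div_le_iff₀ hden]
        linarith
      rw [div_le_iff₀ hU']
      linarith
end
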